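/- Let 1 < α < 2, let β satisfy α-1 ≤ β ≤ 1, and let r := sin(πβ)/(sin(π(α-β)) + sin(πβ)). Then for every integer n ≥ 0 and every x ∈ (0,1), 𝒩_r^α [ (1-x)^{α-β} x^β G_n^{(α-β,β)}(x) ] = λ_n · G_{n+1}^{(β-1, α-β-1)}(x), where λ_n := [sin(πα)/(sin(π(α-β)) + sin(πβ))] · Γ(n+α)/n!. -/

import Mathlib

open Real MeasureTheory

/-- Jacobi polynomial `P_n^{(a,b)}(x)`. -/
noncomputable def jacobiP (a b : ℝ) (n : ℕ) (x : ℝ) : ℝ :=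
  ∑ m ∈ Finset.range (n + 1),
    (1 / 2 ^ n : ℝ) *
      (Real.Gamma ((n : ℝ) + a + 1) /
        (Real.Gamma ((m : ℝ) + 1) * Real.Gamma ((n : ℝ) + a - (m : ℝ) + 1))) *
      (Real.Gamma ((n : ℝ) + b + 1) /
        (Real.Gamma ((n : ℝ) - (m : ℝ) + 1) * Real.Gamma (b + (m : ℝ) + 1))) *
      (x - 1) ^ (n - m) * (x + 1) ^ m

/-- Shifted Jacobi polynomial `G_n^{(a,b)}(t) = P_n^{(a,b)}(2t-1)`. -/
noncomputable def jacobiG (a b : ℝ) (n : ℕ) (t : ℝ) : ℝ :=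
  jacobiP a b n (2 * t - 1)

/-- Left Riemann–Liouville fractional integral `₀I_x^σ w`. -/
noncomputable def leftFracInt (σ : ℝ) (w : ℝ → ℝ) (x : ℝ) : ℝ :=
  (1 / Real.Gamma σ) * ∫ s in (0:ℝ)..x, w s * (x - s) ^ (σ - 1)

/-- Right Riemann–Liouville fractional integral `ₓI₁^σ w`. -/
noncomputable def rightFracInt (σ : ℝ) (w : ℝ → ℝ) (x : ℝ) : ℝ :=
  (1 / Real.Gamma σ) * ∫ s in x..(1:ℝ), w s * (s - x) ^ (σ - 1)

/-- The function whose derivative is `𝒩_r^α w`, namely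
`x ↦ r·(₀I_x^{2-α} w)(x) + (1-r)·(ₓI₁^{2-α} w)(x)`. -/
noncomputable def fracComb (r α : ℝ) (w : ℝ → ℝ) (x : ℝ) : ℝ :=
  r * leftFracInt (2 - α) w x + (1 - r) * rightFracInt (2 - α) w x

/-- The eigenvalue `λ_n = [sin(πα)/(sin(π(α-β))+sin(πβ))]·Γ(n+α)/n!`. -/
noncomputable def lamda (α β : ℝ) (n : ℕ) : ℝ :=
  Real.sin (π * α) / (Real.sin (π * (α - β)) + Real.sin (π * β)) *
    (Real.Gamma ((n : ℝ) + α) / (n.factorial : ℝ))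


/-- The coefficient of `y ^ N` in `(1 + x y) ^ A * (1 + (x - 1) y) ^ B`. -/
noncomputable def binomConv (A B : ℝ) (N : ℕ) (x : ℝ) : ℝ :=
  ∑ ij ∈ Finset.HasAntidiagonal.antidiagonal N,
    Ring.choose A ij.1 * Ring.choose B ij.2 * (x ^ ij.1 * (x - 1) ^ ij.2)

lemma succ_mul_choose_succ (A : ℝ) (i : ℕ) :
    ((i : ℝ) + 1) * Ring.choose A (i + 1) = (A - i) * Ring.choose A i := by
  have h := Ring.choose_smul_choose A (Nat.le_succ i)
  simp only [nsmul_eq_mul, Nat.succ_eq_add_one, Nat.add_sub_cancel_left, Ring.choose_one_right,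
    Nat.choose_succ_self_right] at h
  push_cast at h
  linarith

lemma mul_choose_sub_one (A : ℝ) (i : ℕ) :
    A * Ring.choose (A - 1) i = (A - i) * Ring.choose A i := by
  have h := Ring.choose_smul_choose A (Nat.le_add_left 1 i)
  simp only [nsmul_eq_mul, Ring.choose_one_right, Nat.choose_one_right, Nat.add_sub_cancel] at h
  push_cast at h
  rw [← h, succ_mul_choose_succ]

lemma choose_mul_choose_sub_comm (A : ℝ) (i j : ℕ) :
    Ring.choose A i * Ring.choose (A - i) j = Ring.choose A j * Ring.choose (A - j) i := by
  have h1 := Ring.choose_smul_choose A (Nat.le_add_right i j)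
  have h2 := Ring.choose_smul_choose A (Nat.le_add_left j i)
  rw [Nat.add_sub_cancel_left] at h1
  rw [Nat.add_sub_cancel] at h2
  rw [← h1, ← h2, Nat.choose_symm_add]

lemma binomConv_add_one_left (A B : ℝ) (N : ℕ) (x : ℝ) :
    binomConv (A + 1) B (N + 1) x = binomConv A B (N + 1) x + x * binomConv A B N x := by
  simp only [binomConv, Finset.Nat.sum_antidiagonal_succ, Ring.choose_succ_succ, Finset.mul_sum,
    Ring.choose_zero_right]
  rw [add_assoc, ← Finset.sum_add_distrib]
  congr 1
  exact Finset.sum_congr rfl fun _ _ => by ring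

lemma binomConv_add_one_right (A B : ℝ) (N : ℕ) (x : ℝ) :
    binomConv A (B + 1) (N + 1) x = binomConv A B (N + 1) x + (x - 1) * binomConv A B N x := by
  simp only [binomConv, Finset.Nat.sum_antidiagonal_succ', Ring.choose_succ_succ, Finset.mul_sum,
    Ring.choose_zero_right]
  rw [add_assoc, ← Finset.sum_add_distrib]
  congr 1
  exact Finset.sum_congr rfl fun _ _ => by ring

lemma binomConv_absorb (A B : ℝ) (N : ℕ) (x : ℝ) :
    A * binomConv (A - 1) B N x + B * binomConv A (B - 1) N x
      = (A + B - N) * binomConv A B N x := by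
  simp only [binomConv, Finset.mul_sum]
  rw [← Finset.sum_add_distrib]
  refine Finset.sum_congr rfl fun ij h => ?_
  have hN : (N : ℝ) = ij.1 + ij.2 := by
    exact_mod_cast (Finset.HasAntidiagonal.mem_antidiagonal.1 h).symm
  have h1 := mul_choose_sub_one A ij.1
  have h2 := mul_choose_sub_one B ij.2
  rw [hN]
  linear_combination
    (Ring.choose B ij.2 * (x ^ ij.1 * (x - 1) ^ ij.2)) * h1
      + (Ring.choose A ij.1 * (x ^ ij.1 * (x - 1) ^ ij.2)) * h2

lemma hasDerivAt_binomConv (A B : ℝ) (N : ℕ) (x : ℝ) :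
    HasDerivAt (binomConv A B (N + 1)) ((A + B - N) * binomConv A B N x) x := by
  have h : HasDerivAt (binomConv A B (N + 1))
      (∑ ij ∈ Finset.HasAntidiagonal.antidiagonal (N + 1), Ring.choose A ij.1 * Ring.choose B ij.2 *
        ((ij.1 : ℝ) * x ^ (ij.1 - 1) * (x - 1) ^ ij.2
          + x ^ ij.1 * ((ij.2 : ℝ) * (x - 1) ^ (ij.2 - 1)))) x := by
    unfold binomConv
    refine HasDerivAt.fun_sum fun ij _ => ?_
    refine HasDerivAt.const_mul _ ?_
    refine HasDerivAt.mul (hasDerivAt_pow _ _) ?_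
    simpa using ((hasDerivAt_id x).sub_const 1).fun_pow ij.2
  convert h using 1
  simp only [mul_add, Finset.sum_add_distrib]
  rw [Finset.Nat.sum_antidiagonal_succ, Finset.Nat.sum_antidiagonal_succ']
  simp only [Nat.cast_zero, zero_mul, mul_zero, zero_add, Nat.cast_add, Nat.cast_one,
    Nat.add_sub_cancel]
  rw [← Finset.sum_add_distrib, binomConv, Finset.mul_sum]
  refine Finset.sum_congr rfl fun ij hij => ?_
  have hN : (N : ℝ) = ij.1 + ij.2 := by
    exact_mod_cast (Finset.HasAntidiagonal.mem_antidiagonal.1 hij).symm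
  have h1 := succ_mul_choose_succ A ij.1
  have h2 := succ_mul_choose_succ B ij.2
  rw [hN]
  linear_combination
    -(Ring.choose B ij.2 * (x ^ ij.1 * (x - 1) ^ ij.2)) * h1
      - (Ring.choose A ij.1 * (x ^ ij.1 * (x - 1) ^ ij.2)) * h2

/-- A Vandermonde-type convolution of the polynomials `binomConv`. -/
lemma sum_choose_mul_binomConv (a b : ℝ) (n N : ℕ) (x : ℝ) :
    ∑ m ∈ Finset.range (n + 1), Ring.choose ((n : ℝ) + a) m * Ring.choose ((n : ℝ) + b) (n - m) *
        binomConv (b + m) (a + (n - m : ℕ)) N x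
      = Ring.choose (2 * n + a + b - N) n * binomConv (n + b) (n + a) N x := by
  simp only [binomConv, Finset.mul_sum]
  rw [Finset.sum_comm]
  refine Finset.sum_congr rfl fun ij hij => ?_
  have hN : (N : ℝ) = ij.1 + ij.2 := by
    exact_mod_cast (Finset.HasAntidiagonal.mem_antidiagonal.1 hij).symm
  have hV : (2 * n + a + b - N : ℝ) = (n + a - ij.2) + (n + b - ij.1) := by rw [hN]; ring
  rw [hV, Ring.add_choose_eq _ (Commute.all _ _),
    Finset.Nat.sum_antidiagonal_eq_sum_range_succ_mk, Finset.sum_mul]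
  refine Finset.sum_congr rfl fun m hm => ?_
  have hm : m ≤ n := Nat.lt_succ_iff.1 (Finset.mem_range.1 hm)
  have h1 := choose_mul_choose_sub_comm ((n : ℝ) + a) m ij.2
  have h2 := choose_mul_choose_sub_comm ((n : ℝ) + b) (n - m) ij.1
  rw [show (n : ℝ) + a - m = a + (n - m : ℕ) by push_cast [hm]; ring] at h1
  rw [show (n : ℝ) + b - (n - m : ℕ) = b + m by push_cast [hm]; ring] at h2
  linear_combination
    (Ring.choose ((n : ℝ) + b) (n - m) * Ring.choose (b + m) ij.1 *
      (x ^ ij.1 * (x - 1) ^ ij.2)) * h1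
    + (Ring.choose ((n : ℝ) + a) ij.2 * Ring.choose ((n : ℝ) + a - ij.2) m *
      (x ^ ij.1 * (x - 1) ^ ij.2)) * h2

lemma Gamma_div_eq_choose (z : ℝ) (hz : 0 < z) (m : ℕ) :
    Real.Gamma (z + m) / (Real.Gamma ((m : ℝ) + 1) * Real.Gamma z)
      = Ring.choose (z + m - 1) m := by
  induction m generalizing z with
  | zero => simp [(Real.Gamma_pos_of_pos hz).ne']
  | succ m ih =>
    have h := ih (z + 1) (by linarith)
    have h1 := succ_mul_choose_succ (z + 1 + m - 1) m
    rw [← h, Real.Gamma_add_one hz.ne'] at h1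
    push_cast
    rw [show z + ((m : ℝ) + 1) = z + 1 + m by ring,
      Real.Gamma_add_one (s := (m : ℝ) + 1) (by positivity)]
    have := (Real.Gamma_pos_of_pos hz).ne'
    have := (Real.Gamma_pos_of_pos (show (0 : ℝ) < m + 1 by positivity)).ne'
    have hm : (m : ℝ) + 1 ≠ 0 := by positivity
    apply mul_left_cancel₀ hm
    rw [h1]
    field_simp
    ring

lemma jacobiG_eq_sum (a b : ℝ) (ha : -1 < a) (hb : -1 < b) (n : ℕ) (t : ℝ) :
    jacobiG a b n t = ∑ m ∈ Finset.range (n + 1),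
      Ring.choose ((n : ℝ) + a) m * Ring.choose ((n : ℝ) + b) (n - m) *
        ((t - 1) ^ (n - m) * t ^ m) := by
  unfold jacobiG jacobiP
  refine Finset.sum_congr rfl fun m hm => ?_
  have hm : m ≤ n := Nat.lt_succ_iff.1 (Finset.mem_range.1 hm)
  have hmr : (m : ℝ) ≤ n := by exact_mod_cast hm
  have h1 := Gamma_div_eq_choose ((n : ℝ) + a - m + 1) (by linarith) m
  have h2 := Gamma_div_eq_choose (b + m + 1)
    (by have := Nat.cast_nonneg (α := ℝ) m; linarith) (n - m)
  push_cast [hm] at h2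
  rw [show (n : ℝ) + a - m + 1 + m = n + a + 1 by ring, add_sub_cancel_right] at h1
  rw [show b + m + 1 + ((n : ℝ) - m) = n + b + 1 by ring, add_sub_cancel_right] at h2
  rw [h1, h2, show 2 * t - 1 - 1 = 2 * (t - 1) by ring, show 2 * t - 1 + 1 = 2 * t by ring,
    mul_pow, mul_pow, ← Nat.sub_add_cancel hm, pow_add]
  simp only [Nat.add_sub_cancel]
  field_simp

lemma jacobiG_eq_binomConv (a b : ℝ) (ha : -1 < a) (hb : -1 < b) (n : ℕ) (t : ℝ) :
    jacobiG a b n t = binomConv (n + a) (n + b) n t := by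
  rw [jacobiG_eq_sum a b ha hb, binomConv, Finset.Nat.sum_antidiagonal_eq_sum_range_succ_mk]
  exact Finset.sum_congr rfl fun _ _ => by ring

/-- Euler's integral representing the Gauss hypergeometric function. -/
noncomputable def eulerInt (p q ρ x : ℝ) : ℝ :=
  ∫ t in (0:ℝ)..1, t ^ (p - 1) * (1 - t) ^ (q - 1) * (1 - x * t) ^ ρ

lemma intervalIntegrable_beta {p q : ℝ} (hp : 0 < p) (hq : 0 < q) :
    IntervalIntegrable (fun t : ℝ => t ^ (p - 1) * (1 - t) ^ (q - 1)) volume 0 1 := by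
  have h := Complex.betaIntegral_convergent (u := p) (v := q) (by simpa) (by simpa)
  rw [intervalIntegrable_iff_integrableOn_Ioc_of_le zero_le_one] at h ⊢
  refine IntegrableOn.congr_fun h.re (fun t ht => ?_) measurableSet_Ioc
  have h1 : ((t ^ (p - 1) * (1 - t) ^ (q - 1) : ℝ) : ℂ)
      = (t : ℂ) ^ ((p : ℂ) - 1) * (1 - (t : ℂ)) ^ ((q : ℂ) - 1) := by
    rw [Complex.ofReal_mul, Complex.ofReal_cpow ht.1.le, Complex.ofReal_cpow (sub_nonneg.2 ht.2)]
    push_cast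
    rfl
  simp only [← h1]
  exact Complex.ofReal_re _

lemma one_sub_mul_pos {x t : ℝ} (hx : x < 1) (ht : t ∈ Set.Icc (0:ℝ) 1) : 0 < 1 - x * t := by
  nlinarith [ht.1, ht.2, mul_nonneg ht.1 (sub_pos.2 hx).le]

lemma continuousOn_one_sub_mul_rpow {x : ℝ} (hx : x < 1) (ρ : ℝ) :
    ContinuousOn (fun t : ℝ => (1 - x * t) ^ ρ) (Set.Icc 0 1) :=
  ContinuousOn.rpow_const (by fun_prop) fun _ ht => Or.inl (one_sub_mul_pos hx ht).ne'

lemma intervalIntegrable_eulerInt {p q x : ℝ} (hp : 0 < p) (hq : 0 < q) (hx : x < 1) (ρ : ℝ) :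
    IntervalIntegrable (fun t : ℝ => t ^ (p - 1) * (1 - t) ^ (q - 1) * (1 - x * t) ^ ρ)
      volume 0 1 := by
  refine (intervalIntegrable_beta hp hq).mul_continuousOn ?_
  rw [Set.uIcc_of_le zero_le_one]
  exact continuousOn_one_sub_mul_rpow hx ρ

lemma eulerInt_add_one_mid {p q x : ℝ} (hp : 0 < p) (hq : 0 < q) (hx : x < 1) (ρ : ℝ) :
    eulerInt p (q + 1) ρ x = eulerInt p q ρ x - eulerInt (p + 1) q ρ x := by
  unfold eulerInt
  rw [← intervalIntegral.integral_sub (intervalIntegrable_eulerInt hp hq hx ρ)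
    (intervalIntegrable_eulerInt (by linarith) hq hx ρ)]
  refine intervalIntegral.integral_congr_Ioo_of_le zero_le_one fun t ht => ?_
  have h1 : t ^ (p + 1 - 1) = t ^ (p - 1) * t := by
    rw [← Real.rpow_add_one ht.1.ne']; ring_nf
  have h2 : (1 - t) ^ (q + 1 - 1) = (1 - t) ^ (q - 1) * (1 - t) := by
    rw [← Real.rpow_add_one (sub_pos.2 ht.2).ne']; ring_nf
  rw [h1, h2]
  ring

lemma eulerInt_add_one_right {p q x : ℝ} (hp : 0 < p) (hq : 0 < q) (hx : x < 1) (ρ : ℝ) :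
    eulerInt p q (ρ + 1) x = eulerInt p q ρ x - x * eulerInt (p + 1) q ρ x := by
  unfold eulerInt
  rw [← intervalIntegral.integral_const_mul,
    ← intervalIntegral.integral_sub (intervalIntegrable_eulerInt hp hq hx ρ)
    ((intervalIntegrable_eulerInt (by linarith) hq hx ρ).const_mul x)]
  refine intervalIntegral.integral_congr_Ioo_of_le zero_le_one fun t ht => ?_
  have h1 : t ^ (p + 1 - 1) = t ^ (p - 1) * t := by
    rw [← Real.rpow_add_one ht.1.ne']; ring_nf
  rw [h1, Real.rpow_add_one (one_sub_mul_pos hx (Set.Ioo_subset_Icc_self ht)).ne']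
  ring

lemma eulerInt_parts {p q x : ℝ} (hp : 0 < p) (hq : 0 < q) (hx : x < 1) (ρ : ℝ) :
    p * eulerInt p (q + 1) ρ x - q * eulerInt (p + 1) q ρ x
      - ρ * x * eulerInt (p + 1) (q + 1) (ρ - 1) x = 0 := by
  have i1 := (intervalIntegrable_eulerInt (q := q + 1) hp (by linarith) hx ρ).const_mul p
  have i2 := (intervalIntegrable_eulerInt (p := p + 1) (by linarith) hq hx ρ).const_mul q
  have i3 := (intervalIntegrable_eulerInt (p := p + 1) (q := q + 1) (by linarith) (by linarith) hx
    (ρ - 1)).const_mul (ρ * x)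
  unfold eulerInt
  rw [← intervalIntegral.integral_const_mul, ← intervalIntegral.integral_const_mul,
    ← intervalIntegral.integral_const_mul, ← intervalIntegral.integral_sub i1 i2,
    ← intervalIntegral.integral_sub (i1.sub i2) i3,
    intervalIntegral.integral_eq_sub_of_hasDerivAt_of_le
      (f := fun t : ℝ => t ^ p * (1 - t) ^ q * (1 - x * t) ^ ρ) zero_le_one]
  · simp [Real.zero_rpow hp.ne', Real.zero_rpow hq.ne']
  · refine ContinuousOn.mul (ContinuousOn.mul ?_ ?_) (continuousOn_one_sub_mul_rpow hx ρ)
    · exact (Real.continuous_rpow_const hp.le).continuousOn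
    · exact ContinuousOn.rpow_const (by fun_prop) fun _ _ => Or.inr hq.le
  · intro t ht
    have ht' := Set.Ioo_subset_Icc_self ht
    have h1 : HasDerivAt (fun t : ℝ => t ^ p) (p * t ^ (p - 1)) t :=
      Real.hasDerivAt_rpow_const (Or.inl ht.1.ne')
    have h2 : HasDerivAt (fun t : ℝ => (1 - t) ^ q) (-1 * q * (1 - t) ^ (q - 1)) t :=
      ((hasDerivAt_id t).const_sub 1).rpow_const (Or.inl (sub_pos.2 ht.2).ne')
    have h3 : HasDerivAt (fun t : ℝ => (1 - x * t) ^ ρ) (-x * ρ * (1 - x * t) ^ (ρ - 1)) t := by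
      have : HasDerivAt (fun t : ℝ => 1 - x * t) (-x) t := by
        simpa using ((hasDerivAt_id t).const_mul x).const_sub 1
      exact this.rpow_const (Or.inl (one_sub_mul_pos hx ht').ne')
    refine ((h1.mul h2).mul h3).congr_deriv ?_
    simp only [add_sub_cancel_right, Pi.mul_apply]
    ring
  · exact (i1.sub i2).sub i3

lemma hasDerivAt_eulerInt {p q x : ℝ} (hp : 0 < p) (hq : 0 < q) (hx : x < 1) (ρ : ℝ) :
    HasDerivAt (eulerInt p q ρ) (-ρ * eulerInt (p + 1) q (ρ - 1) x) x := by
  obtain ⟨y, hxy, hy⟩ := exists_between hx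
  have hc : ContinuousOn (fun z : ℝ × ℝ => -ρ * z.2 * (1 - z.1 * z.2) ^ (ρ - 1))
      (Set.Icc (x - 1) y ×ˢ Set.Icc 0 1) := by
    refine ContinuousOn.mul (by fun_prop) (ContinuousOn.rpow_const (by fun_prop) ?_)
    rintro ⟨z, t⟩ ⟨hz, ht⟩
    exact Or.inl (one_sub_mul_pos (hz.2.trans_lt hy) ht).ne'
  obtain ⟨K, hK⟩ := (isCompact_Icc.prod isCompact_Icc).exists_bound_of_continuousOn hc
  have hmeas : ∀ ρ' z : ℝ, AEStronglyMeasurable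
      (fun t : ℝ => t ^ (p - 1) * (1 - t) ^ (q - 1) * (1 - z * t) ^ ρ')
      (volume.restrict (Set.uIoc 0 1)) := fun _ _ => by
    refine Measurable.aestronglyMeasurable ?_
    fun_prop
  have hev : eulerInt (p + 1) q (ρ - 1) x = ∫ t in (0:ℝ)..1,
      t ^ (p - 1) * (1 - t) ^ (q - 1) * (t * (1 - x * t) ^ (ρ - 1)) := by
    refine intervalIntegral.integral_congr_Ioo_of_le zero_le_one fun t ht => ?_
    have h1 : t ^ (p + 1 - 1) = t ^ (p - 1) * t := by
      rw [← Real.rpow_add_one ht.1.ne']; ring_nf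
    rw [h1]; ring
  have h := (intervalIntegral.hasDerivAt_integral_of_dominated_loc_of_deriv_le (μ := volume)
    (F := fun x t : ℝ => t ^ (p - 1) * (1 - t) ^ (q - 1) * (1 - x * t) ^ ρ)
    (F' := fun x t : ℝ => t ^ (p - 1) * (1 - t) ^ (q - 1) * (-ρ * t * (1 - x * t) ^ (ρ - 1)))
    (bound := fun t : ℝ => t ^ (p - 1) * (1 - t) ^ (q - 1) * K) (a := 0) (b := 1)
    (Icc_mem_nhds (sub_one_lt x) hxy) (Filter.Eventually.of_forall fun z => hmeas ρ z)
    (intervalIntegrable_eulerInt hp hq hx ρ) ?_ ?_ ?_ ?_).2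
  · refine h.congr_deriv ?_
    rw [hev, ← intervalIntegral.integral_const_mul]
    exact intervalIntegral.integral_congr_Ioo_of_le zero_le_one fun t _ => by ring
  · refine Measurable.aestronglyMeasurable ?_
    fun_prop
  · refine Filter.Eventually.of_forall fun t ht z hz => ?_
    rw [Set.uIoc_of_le zero_le_one] at ht
    have h0 : 0 ≤ t ^ (p - 1) * (1 - t) ^ (q - 1) :=
      mul_nonneg (Real.rpow_nonneg ht.1.le _) (Real.rpow_nonneg (sub_nonneg.2 ht.2) _)
    rw [norm_mul, Real.norm_of_nonneg h0]
    exact mul_le_mul_of_nonneg_left (hK (z, t) ⟨hz, ht.1.le, ht.2⟩) h0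
  · exact (intervalIntegrable_beta hp hq).mul_const K
  · refine Filter.Eventually.of_forall fun t ht z hz => ?_
    rw [Set.uIoc_of_le zero_le_one] at ht
    refine HasDerivAt.const_mul _ ?_
    have : HasDerivAt (fun z : ℝ => 1 - z * t) (-t) z := by
      simpa using ((hasDerivAt_id z).mul_const t).const_sub 1
    exact (this.rpow_const (Or.inl
      (one_sub_mul_pos (hz.2.trans_lt hy) ⟨ht.1.le, ht.2⟩).ne')).congr_deriv (by ring)

lemma integral_rpow_mul_one_sub_rpow {p q : ℝ} (hp : 0 < p) (hq : 0 < q) :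
    ∫ t in (0:ℝ)..1, t ^ (p - 1) * (1 - t) ^ (q - 1)
      = Real.Gamma p * Real.Gamma q / Real.Gamma (p + q) := by
  rw [← ProbabilityTheory.beta, ProbabilityTheory.beta_eq_betaIntegralReal p q hp hq,
    Complex.betaIntegral]
  rw [intervalIntegral.integral_congr
      (g := fun t : ℝ => ((t ^ (p - 1) * (1 - t) ^ (q - 1) : ℝ) : ℂ)),
    intervalIntegral.integral_ofReal, Complex.ofReal_re]
  intro t ht
  rw [Set.uIcc_of_le zero_le_one] at ht
  simp only
  rw [Complex.ofReal_mul, Complex.ofReal_cpow ht.1, Complex.ofReal_cpow (sub_nonneg.2 ht.2)]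
  push_cast
  rfl

lemma eulerInt_neg_add {p q x : ℝ} (hp : 0 < p) (hq : 0 < q) (hx : x < 1) :
    eulerInt p q (-(p + q)) x
      = Real.Gamma p * Real.Gamma q / Real.Gamma (p + q) * (1 - x) ^ (-p) := by
  have hd : ∀ z < 1, HasDerivAt (fun z => eulerInt p q (-(p + q)) z * (1 - z) ^ p) 0 z := by
    intro z hz
    have h1 := hasDerivAt_eulerInt hp hq hz (-(p + q))
    have h2 : HasDerivAt (fun t : ℝ => (1 - t) ^ p) (-1 * p * (1 - z) ^ (p - 1)) z :=
      ((hasDerivAt_id z).const_sub 1).rpow_const (Or.inl (sub_pos.2 hz).ne')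
    refine (h1.mul h2).congr_deriv ?_
    have e1 := eulerInt_parts hp hq hz (-(p + q))
    have e2 := eulerInt_add_one_mid hp hq hz (-(p + q))
    have e3 := eulerInt_add_one_mid (p := p + 1) (by linarith) hq hz (-(p + q) - 1)
    have e5 := eulerInt_add_one_right (p := p + 1) (by linarith) hq hz (-(p + q) - 1)
    rw [sub_add_cancel] at e5
    have e6 : (1 - z) ^ p = (1 - z) ^ (p - 1) * (1 - z) := by
      rw [← Real.rpow_add_one (sub_pos.2 hz).ne', sub_add_cancel]
    rw [e6]
    rw [e2, e3] at e1
    linear_combination (-(1 - z) ^ (p - 1)) * e1 - ((p + q) * (1 - z) ^ (p - 1)) * e5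
  have hc := (convex_Iio (1:ℝ)).is_const_of_fderivWithin_eq_zero (𝕜 := ℝ)
    (f := fun z => eulerInt p q (-(p + q)) z * (1 - z) ^ p)
    (fun z hz => (hd z hz).differentiableAt.differentiableWithinAt)
    (fun z hz => by
      rw [fderivWithin_of_isOpen isOpen_Iio hz, (hd z hz).hasFDerivAt.fderiv]; ext; simp) hx
    (show (0:ℝ) < 1 from one_pos)
  have h0 : eulerInt p q (-(p + q)) 0 = Real.Gamma p * Real.Gamma q / Real.Gamma (p + q) := by
    rw [← integral_rpow_mul_one_sub_rpow hp hq]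
    simp [eulerInt]
  simp only [h0, sub_zero, Real.one_rpow, mul_one] at hc
  rw [← hc, mul_assoc, ← Real.rpow_add (sub_pos.2 hx)]
  simp

lemma tendsto_eulerInt_one {p q ρ : ℝ} (hp : 0 < p) (hq : 0 < q) (hρ : 0 ≤ ρ) :
    Filter.Tendsto (eulerInt p q ρ) (nhdsWithin 1 (Set.Iio 1))
      (nhds (Real.Gamma p * Real.Gamma (q + ρ) / Real.Gamma (p + (q + ρ)))) := by
  have h1 : eulerInt p q ρ 1 = Real.Gamma p * Real.Gamma (q + ρ) / Real.Gamma (p + (q + ρ)) := by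
    rw [← integral_rpow_mul_one_sub_rpow hp (by linarith)]
    refine intervalIntegral.integral_congr_Ioo_of_le zero_le_one fun t ht => ?_
    rw [one_mul, mul_assoc, ← Real.rpow_add (sub_pos.2 ht.2)]
    ring_nf
  rw [← h1]
  refine intervalIntegral.continuousWithinAt_of_dominated_interval
    (bound := fun t : ℝ => t ^ (p - 1) * (1 - t) ^ (q - 1)) ?_ ?_ (intervalIntegrable_beta hp hq) ?_
  · refine Filter.Eventually.of_forall fun z => Measurable.aestronglyMeasurable ?_
    fun_prop
  · have : Set.Ioo (0:ℝ) 1 ∈ nhdsWithin 1 (Set.Iio 1) := Ioo_mem_nhdsLT one_pos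
    filter_upwards [this] with z hz
    refine Filter.Eventually.of_forall fun t ht => ?_
    rw [Set.uIoc_of_le zero_le_one] at ht
    have h0 : 0 ≤ t ^ (p - 1) * (1 - t) ^ (q - 1) :=
      mul_nonneg (Real.rpow_nonneg ht.1.le _) (Real.rpow_nonneg (sub_nonneg.2 ht.2) _)
    have h2 := one_sub_mul_pos hz.2 ⟨ht.1.le, ht.2⟩
    rw [norm_mul, Real.norm_of_nonneg h0, Real.norm_of_nonneg (Real.rpow_nonneg h2.le _)]
    refine mul_le_of_le_one_right h0 (Real.rpow_le_one h2.le ?_ hρ)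
    linarith [mul_nonneg hz.1.le ht.1.le]
  · refine Filter.Eventually.of_forall fun t _ => Continuous.continuousWithinAt ?_
    exact continuous_const.mul (Continuous.rpow_const (by fun_prop) fun _ => Or.inr hρ)

/-- For `0 < x < 1` this is `∫ s in 0..x, s ^ A * (1 - s) ^ B * (x - s) ^ (σ - 1)`. -/
noncomputable def leftInt (σ A B x : ℝ) : ℝ :=
  x ^ (A + σ) * eulerInt (A + 1) σ B x

lemma leftInt_split {σ A x : ℝ} (hσ : 0 < σ) (hA : -1 < A) (hx0 : 0 < x) (hx1 : x < 1) (B : ℝ) :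
    leftInt σ (A + 1) B x + leftInt σ A (B + 1) x = leftInt σ A B x := by
  have h1 := eulerInt_add_one_right (p := A + 1) (by linarith) hσ hx1 B
  have h2 : x ^ (A + 1 + σ) = x ^ (A + σ) * x := by
    rw [← Real.rpow_add_one hx0.ne']; ring_nf
  rw [leftInt, leftInt, leftInt, h1, h2]
  ring

lemma leftInt_parts {σ A x : ℝ} (hσ : 0 < σ) (hA : 0 < A) (hx0 : 0 < x) (hx1 : x < 1) (B : ℝ) :
    A * (x * leftInt σ (A - 1) B x - leftInt σ A B x)
      - B * (x * leftInt σ A (B - 1) x - leftInt σ (A + 1) (B - 1) x)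
      - σ * leftInt σ A B x = 0 := by
  have e1 := eulerInt_parts hA hσ hx1 B
  have e2 := eulerInt_add_one_mid hA hσ hx1 B
  have e3 := eulerInt_add_one_mid (p := A + 1) (by linarith) hσ hx1 (B - 1)
  have h2 : x ^ (A + 1 + σ) = x ^ (A + σ) * x := by
    rw [← Real.rpow_add_one hx0.ne']; ring_nf
  have h3 : x ^ (A + σ) = x ^ (A - 1 + σ) * x := by
    rw [← Real.rpow_add_one hx0.ne']; ring_nf
  rw [e2, e3] at e1
  simp only [leftInt, h2, sub_add_cancel]
  rw [h3]
  linear_combination (x ^ (A - 1 + σ) * x) * e1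

lemma hasDerivAt_mul_leftInt_sub {σ A x : ℝ} (hσ : 0 < σ) (hA : -1 < A) (hx0 : 0 < x)
    (hx1 : x < 1) (B : ℝ) :
    HasDerivAt (fun y => y * leftInt σ A B y - leftInt σ (A + 1) B y) (σ * leftInt σ A B x) x := by
  have hA' : 0 < A + 1 := by linarith
  have h1 : HasDerivAt (fun y => y ^ (A + σ + 1) * eulerInt (A + 1) (σ + 1) B y)
      (σ * leftInt σ A B x) x := by
    have d1 : HasDerivAt (fun y : ℝ => y ^ (A + σ + 1)) ((A + σ + 1) * x ^ (A + σ + 1 - 1)) x :=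
      Real.hasDerivAt_rpow_const (Or.inl hx0.ne')
    refine (d1.mul (hasDerivAt_eulerInt hA' (by linarith : 0 < σ + 1) hx1 B)).congr_deriv ?_
    have e1 := eulerInt_parts hA' hσ hx1 B
    have e2 := eulerInt_add_one_mid hA' hσ hx1 B
    rw [leftInt, add_sub_cancel_right, Real.rpow_add_one hx0.ne']
    linear_combination x ^ (A + σ) * e1 + (σ * x ^ (A + σ)) * e2
  refine h1.congr_of_eventuallyEq ?_
  filter_upwards [Ioo_mem_nhds hx0 hx1] with y hy
  have h2 : y ^ (A + 1 + σ) = y ^ (A + σ) * y := by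
    rw [← Real.rpow_add_one hy.1.ne']; ring_nf
  rw [leftInt, leftInt, h2, eulerInt_add_one_mid hA' hσ hy.2, Real.rpow_add_one hy.1.ne']
  ring

lemma hasDerivAt_leftInt {σ A B x : ℝ} (hσ : 0 < σ) (hA : -1 < A) (hx0 : 0 < x)
    (hx1 : x < 1) (hAB : A + B + σ = 0) :
    HasDerivAt (leftInt σ A B)
      (-B * (Real.Gamma (A + 1) * Real.Gamma σ / Real.Gamma (1 - B))
        * (x ^ (-B - 1) * (1 - x) ^ (-A - 1))) x := by
  have hA' : 0 < A + 1 := by linarith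
  have d1 : HasDerivAt (fun y : ℝ => y ^ (A + σ)) ((A + σ) * x ^ (A + σ - 1)) x :=
    Real.hasDerivAt_rpow_const (Or.inl hx0.ne')
  refine (d1.mul (hasDerivAt_eulerInt hA' hσ hx1 B)).congr_deriv ?_
  have e1 := eulerInt_add_one_right hA' hσ hx1 (B - 1)
  have e2 := eulerInt_neg_add hA' hσ hx1
  rw [show -(A + 1 + σ) = B - 1 by linarith, show A + 1 + σ = 1 - B by linarith,
    show -(A + 1) = -A - 1 by ring] at e2
  rw [sub_add_cancel] at e1
  have h3 : x ^ (-B) = x ^ (-B - 1) * x := by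
    rw [← Real.rpow_add_one hx0.ne']; ring_nf
  rw [show A + σ = -B by linarith, h3]
  linear_combination (-B * x ^ (-B - 1)) * e1 + (-B * x ^ (-B - 1)) * e2

lemma tendsto_leftInt_zero {σ A : ℝ} (hσ : 0 < σ) (hA : 0 < A) (B : ℝ) :
    Filter.Tendsto (leftInt σ A B) (nhdsWithin 0 (Set.Ioi 0)) (nhds 0) := by
  have h1 : ContinuousAt (leftInt σ A B) 0 :=
    (Real.continuousAt_rpow_const 0 (A + σ) (Or.inr (by linarith))).mul
      (hasDerivAt_eulerInt (p := A + 1) (by linarith) hσ one_pos B).continuousAt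
  have h2 : leftInt σ A B 0 = 0 := by
    rw [leftInt, Real.zero_rpow (by linarith), zero_mul]
  have h3 := h1.tendsto
  rw [h2] at h3
  exact h3.mono_left nhdsWithin_le_nhds

lemma tendsto_leftInt_one_sub {σ A B : ℝ} (hσ : 0 < σ) (hA : 0 < A) (hB : 0 < B) :
    Filter.Tendsto (fun x => leftInt σ B A (1 - x)) (nhdsWithin 0 (Set.Ioi 0))
      (nhds (Real.Gamma (B + 1) * Real.Gamma (σ + A) / Real.Gamma (B + 1 + (σ + A)))) := by
  have h1 : Filter.Tendsto (fun x : ℝ => 1 - x) (nhdsWithin 0 (Set.Ioi 0))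
      (nhdsWithin 1 (Set.Iio 1)) := by
    refine tendsto_nhdsWithin_iff.2 ⟨?_, ?_⟩
    · have : Filter.Tendsto (fun x : ℝ => 1 - x) (nhds 0) (nhds (1 - 0)) :=
        (continuous_const.sub continuous_id).tendsto 0
      rw [sub_zero] at this
      exact this.mono_left nhdsWithin_le_nhds
    · filter_upwards [self_mem_nhdsWithin] with x hx
      exact sub_lt_self (1:ℝ) (Set.mem_Ioi.1 hx)
  have h2 : Filter.Tendsto (fun y : ℝ => y ^ (B + σ)) (nhdsWithin 1 (Set.Iio 1)) (nhds 1) := by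
    have := (Real.continuousAt_rpow_const 1 (B + σ) (Or.inl one_ne_zero)).tendsto
    rw [Real.one_rpow] at this
    exact this.mono_left nhdsWithin_le_nhds
  have h3 := (h2.mul (tendsto_eulerInt_one (p := B + 1) (by linarith) hσ hA.le)).comp h1
  rw [one_mul] at h3
  exact h3

/-- For `0 < x < 1` this is `∫ s in 0..1, s ^ A * (1 - s) ^ B * k (x - s)` with the kernel
`k u = r * u ^ (σ - 1)` for `0 < u` and `k u = (1 - r) * (-u) ^ (σ - 1)` for `u < 0`. -/
noncomputable def combInt (r σ A B x : ℝ) : ℝ :=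
  r * leftInt σ A B x + (1 - r) * leftInt σ B A (1 - x)

section combInt

variable {r σ A B x : ℝ}

lemma combInt_symm (r σ A B x : ℝ) : combInt (1 - r) σ B A (1 - x) = combInt r σ A B x := by
  simp only [combInt, sub_sub_cancel]
  ring

lemma combInt_split (hσ : 0 < σ) (hA : -1 < A) (hB : -1 < B) (hx0 : 0 < x) (hx1 : x < 1) :
    combInt r σ (A + 1) B x + combInt r σ A (B + 1) x = combInt r σ A B x := by
  have h1 := leftInt_split hσ hA hx0 hx1 B
  have h2 := leftInt_split hσ hB (sub_pos.2 hx1) (sub_lt_self 1 hx0) A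
  simp only [combInt]
  linear_combination r * h1 + (1 - r) * h2

lemma combInt_parts (hσ : 0 < σ) (hA : 0 < A) (hB : 0 < B) (hx0 : 0 < x) (hx1 : x < 1) :
    A * (x * combInt r σ (A - 1) B x - combInt r σ A B x)
      - B * (x * combInt r σ A (B - 1) x - combInt r σ (A + 1) (B - 1) x)
      - σ * combInt r σ A B x = 0 := by
  have hy0 := sub_pos.2 hx1
  have hy1 := sub_lt_self 1 hx0
  have h1 := leftInt_parts hσ hA hx0 hx1 B
  have h2 := leftInt_parts hσ hB hy0 hy1 A
  have h3 := leftInt_split (A := B) hσ (by linarith) hy0 hy1 (A - 1)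
  have h4 := leftInt_split (A := B - 1) hσ (by linarith) hy0 hy1 A
  rw [sub_add_cancel] at h3 h4
  simp only [combInt]
  linear_combination r * h1 + (1 - r) * h2 - (1 - r) * A * h3 + (1 - r) * B * h4

lemma hasDerivAt_mul_combInt_sub (hσ : 0 < σ) (hA : -1 < A) (hB : -1 < B) (hx0 : 0 < x)
    (hx1 : x < 1) :
    HasDerivAt (fun y => y * combInt r σ A B y - combInt r σ (A + 1) B y)
      (σ * combInt r σ A B x) x := by
  have h1 := hasDerivAt_mul_leftInt_sub hσ hA hx0 hx1 B
  have h2 := (hasDerivAt_mul_leftInt_sub hσ hB (sub_pos.2 hx1) (sub_lt_self 1 hx0) A).comp x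
    ((hasDerivAt_id x).const_sub 1)
  have h3 := (h1.const_mul r).sub (h2.const_mul (1 - r))
  refine (h3.congr_deriv ?_).congr_of_eventuallyEq ?_
  · simp only [combInt]
    ring
  · filter_upwards [Ioo_mem_nhds hx0 hx1] with y hy
    have h4 := leftInt_split hσ hB (sub_pos.2 hy.2) (sub_lt_self 1 hy.1) A
    simp only [combInt, Pi.sub_apply, Function.comp_apply]
    linear_combination (-(1 - r)) * h4

lemma tendsto_combInt_zero (hσ : 0 < σ) (hA : 0 < A) (hB : 0 < B) :
    Filter.Tendsto (combInt r σ A B) (nhdsWithin 0 (Set.Ioi 0))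
      (nhds ((1 - r) *
        (Real.Gamma (B + 1) * Real.Gamma (σ + A) / Real.Gamma (B + 1 + (σ + A))))) := by
  have h := ((tendsto_leftInt_zero hσ hA B).const_mul r).add
    ((tendsto_leftInt_one_sub hσ hA hB).const_mul (1 - r))
  rw [mul_zero, zero_add] at h
  exact h

end combInt

lemma binomConv_split (A B : ℝ) (N : ℕ) (x : ℝ) :
    binomConv (A + 1) B (N + 1) x - binomConv A (B + 1) (N + 1) x = binomConv A B N x := by
  rw [binomConv_add_one_left, binomConv_add_one_right]
  ring

lemma binomConv_parts (A B : ℝ) (N : ℕ) (x : ℝ) :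
    A * (binomConv A B (N + 1) x - x * binomConv (A - 1) B N x)
      + B * (binomConv (A + 1) (B - 1) (N + 1) x - x * binomConv A (B - 1) N x)
      + (N + 1 - A - B) * binomConv A B (N + 1) x = 0 := by
  have h1 := binomConv_absorb A B (N + 1) x
  have h2 := binomConv_add_one_left (A - 1) B N x
  have h3 := binomConv_add_one_left A (B - 1) N x
  rw [sub_add_cancel] at h2
  push_cast at h1
  linear_combination h1 + A * h2 + B * h3

section base

variable {r σ a b C : ℝ}

lemma combInt_eq_of_const (hσ : 0 < σ) (ha : 0 < a) (hb : 0 < b) (hab : a + b + σ = 2)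
    (hC : ∀ x ∈ Set.Ioo (0:ℝ) 1, combInt r σ (b - 1) (a - 1) x = C) :
    ∀ x ∈ Set.Ioo (0:ℝ) 1, combInt r σ b (a - 1) x = C * ((1 - a) + (1 - σ) * x) := by
  have d1 : ∀ x ∈ Set.Ioo (0:ℝ) 1,
      HasDerivAt (combInt r σ b (a - 1)) ((1 - σ) * C) x := by
    intro x hx
    have h1 := hasDerivAt_mul_combInt_sub (r := r) (A := b - 1) (B := a - 1) hσ (by linarith)
      (by linarith) hx.1 hx.2
    rw [hC x hx, sub_add_cancel] at h1
    refine ((((hasDerivAt_id x).mul_const C).sub h1).congr_deriv ?_).congr_of_eventuallyEq ?_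
    · ring
    · filter_upwards [Ioo_mem_nhds hx.1 hx.2] with y hy
      simp [hC y hy]
  have d2 : ∀ x ∈ Set.Ioo (0:ℝ) 1, HasDerivAt (combInt r σ (b + 1) (a - 1))
      ((1 - σ) * combInt r σ b (a - 1) x + x * ((1 - σ) * C)) x := by
    intro x hx
    have h1 := hasDerivAt_mul_combInt_sub (r := r) (A := b) (B := a - 1) hσ (by linarith)
      (by linarith) hx.1 hx.2
    refine ((((hasDerivAt_id x).mul (d1 x hx)).sub h1).congr_deriv ?_).congr_of_eventuallyEq ?_
    · simp only [id]
      ring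
    · filter_upwards with y
      simp
  have hz : ∀ x ∈ Set.Ioo (0:ℝ) 1, b * C * x - (b + σ + (a + b) * x) * combInt r σ b (a - 1) x
      + 2 * combInt r σ (b + 1) (a - 1) x = 0 := by
    intro x hx
    have h1 := combInt_parts (r := r) hσ hb ha hx.1 hx.2
    have h2 := combInt_split (r := r) (A := b - 1) (B := a - 1) hσ (by linarith) (by linarith)
      hx.1 hx.2
    have h3 := combInt_split (r := r) (A := b) (B := a - 1) hσ (by linarith) (by linarith)
      hx.1 hx.2
    rw [hC x hx, sub_add_cancel, sub_add_cancel] at h2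
    rw [sub_add_cancel] at h3
    linear_combination h1 - b * x * h2 + (b + σ) * h3 - combInt r σ (b + 1) (a - 1) x * hab
  intro x hx
  have hd := (((hasDerivAt_id x).const_mul (b * C)).sub
    ((((hasDerivAt_id x).const_mul (a + b)).const_add (b + σ)).mul (d1 x hx))).add
      ((d2 x hx).const_mul 2)
  have h0 := hd.unique ((hasDerivAt_const x (0:ℝ)).congr_of_eventuallyEq (by
    filter_upwards [Ioo_mem_nhds hx.1 hx.2] with y hy
    exact hz y hy))
  simp only [id] at h0
  refine mul_left_cancel₀ hσ.ne' ?_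
  obtain rfl : a = 2 - b - σ := by linarith
  linear_combination -h0

lemma combInt_eq_binomConv_of_const (hσ : 0 < σ) (ha : 0 < a) (hb : 0 < b) (hab : a + b + σ = 2)
    (hC : ∀ x ∈ Set.Ioo (0:ℝ) 1, combInt r σ (b - 1) (a - 1) x = C) (k l : ℕ) {x : ℝ}
    (hx : x ∈ Set.Ioo (0:ℝ) 1) :
    combInt r σ (b - 1 + k) (a - 1 + l) x
      = C * (-1) ^ l * binomConv (b - 1 + k) (a - 1 + l) (k + l) x := by
  induction l generalizing k with
  | zero =>
    simp only [Nat.cast_zero, add_zero, pow_zero, mul_one]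
    induction k using Nat.twoStepInduction with
    | zero => simp [hC x hx, binomConv]
    | one =>
      have h := combInt_eq_of_const hσ ha hb hab hC x hx
      have h2 : binomConv b (a - 1) 1 x = b * x + (a - 1) * (x - 1) := by
        simp [binomConv, Finset.Nat.sum_antidiagonal_succ]
        ring
      simp only [Nat.cast_one, sub_add_cancel, h, h2]
      linear_combination (-C * x) * hab
    | more k ih0 ih1 =>
      have e1 : b - 1 + ((k + 1 : ℕ) : ℝ) = b + k := by push_cast; ring
      have e2 : b - 1 + ((k + 1 + 1 : ℕ) : ℝ) = b + k + 1 := by push_cast; ring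
      have e0 : b - 1 + (k : ℝ) = b + k - 1 := by ring
      rw [e0] at ih0
      rw [e1] at ih1
      rw [e2]
      have hA : 0 < b + k := by positivity
      have h1 := combInt_parts (r := r) hσ hA ha hx.1 hx.2
      have h2 := combInt_split (r := r) (A := b + k - 1) (B := a - 1) hσ (by linarith)
        (by linarith) hx.1 hx.2
      have h3 := combInt_split (r := r) (A := b + k) (B := a - 1) hσ (by linarith) (by linarith)
        hx.1 hx.2
      have h1' := binomConv_parts (b + k) a (k + 1) x
      have h2' := binomConv_split (b + k - 1) (a - 1) k x
      have h3' := binomConv_split (b + k) (a - 1) (k + 1) x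
      rw [sub_add_cancel, sub_add_cancel] at h2 h2'
      rw [sub_add_cancel] at h3 h3'
      push_cast at h1'
      have hk : (k : ℝ) + 2 ≠ 0 := by positivity
      refine mul_left_cancel₀ hk ?_
      obtain rfl : σ = 2 - a - b := by linarith
      linear_combination h1 - (b + k) * x * h2 + (2 - a + k) * h3
        - C * (h1' - (b + k) * x * h2' + (2 - a + k) * h3')
        + (2 - a + k + (b + k) * x + a * x) * ih1 - (b + k) * x * ih0
  | succ l ih =>
    have e1 : b - 1 + ((k + 1 : ℕ) : ℝ) = b - 1 + k + 1 := by push_cast; ring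
    have e2 : a - 1 + ((l + 1 : ℕ) : ℝ) = a - 1 + l + 1 := by push_cast; ring
    have ih0 := ih k
    have ih1 := ih (k + 1)
    rw [e1, Nat.add_right_comm] at ih1
    have hk : (0:ℝ) ≤ k := k.cast_nonneg
    have hl : (0:ℝ) ≤ l := l.cast_nonneg
    have h1 := combInt_split (r := r) (A := b - 1 + k) (B := a - 1 + l) hσ (by linarith)
      (by linarith) hx.1 hx.2
    have h2 := binomConv_split (b - 1 + k) (a - 1 + l) (k + l) x
    rw [e2, ← add_assoc k]
    rw [pow_succ]
    linear_combination h1 + ih0 - ih1 - C * (-1) ^ l * h2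

end base

lemma Gamma_mul_Gamma_two_sub_mul_sin {a : ℝ} (ha0 : 0 < a) (ha : a ≤ 1) :
    Real.Gamma a * Real.Gamma (2 - a) * Real.sin (π * a) = (1 - a) * π := by
  rcases ha.eq_or_lt with rfl | ha
  · simp
  have hs : Real.sin (π * a) ≠ 0 :=
    (Real.sin_pos_of_pos_of_lt_pi (by positivity) (by nlinarith [Real.pi_pos])).ne'
  have h1 := Real.Gamma_mul_Gamma_one_sub a
  rw [eq_div_iff hs] at h1
  rw [show 2 - a = 1 - a + 1 by ring, Real.Gamma_add_one (sub_pos.2 ha).ne']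
  linear_combination (1 - a) * h1

section constant

variable {r σ a b : ℝ}

lemma exists_combInt_eq_const (hσ : 0 < σ) (ha : 0 < a) (hb : 0 < b) (ha1 : a ≤ 1) (hb1 : b ≤ 1)
    (hab : a + b + σ = 2)
    (hr : r * Real.sin (π * a) = (1 - r) * Real.sin (π * b)) :
    ∃ C, ∀ x ∈ Set.Ioo (0:ℝ) 1, combInt r σ (b - 1) (a - 1) x = C := by
  have hga := (Real.Gamma_pos_of_pos (show 0 < 2 - a by linarith)).ne'
  have hgb := (Real.Gamma_pos_of_pos (show 0 < 2 - b by linarith)).ne'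
  have hG : r * (1 - a) * (Real.Gamma b / Real.Gamma (2 - a))
      = (1 - r) * (1 - b) * (Real.Gamma a / Real.Gamma (2 - b)) := by
    field_simp
    refine mul_left_cancel₀ Real.pi_pos.ne' ?_
    have h1 := Gamma_mul_Gamma_two_sub_mul_sin ha ha1
    have h2 := Gamma_mul_Gamma_two_sub_mul_sin hb hb1
    linear_combination (-r * Real.Gamma b * Real.Gamma (2 - b)) * h1
      + ((1 - r) * Real.Gamma a * Real.Gamma (2 - a)) * h2
      + Real.Gamma a * Real.Gamma (2 - a) * Real.Gamma b * Real.Gamma (2 - b) * hr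
  have hd : ∀ x ∈ Set.Ioo (0:ℝ) 1, HasDerivAt (combInt r σ (b - 1) (a - 1)) 0 x := by
    intro x hx
    have h1 := hasDerivAt_leftInt (A := b - 1) (B := a - 1) hσ (by linarith) hx.1 hx.2
      (by linarith)
    have h2 := (hasDerivAt_leftInt (A := a - 1) (B := b - 1) hσ (by linarith)
      (sub_pos.2 hx.2) (sub_lt_self 1 hx.1) (by linarith)).comp x
      ((hasDerivAt_id x).const_sub 1)
    refine ((h1.const_mul r).add (h2.const_mul (1 - r))).congr_deriv ?_
    rw [show 1 - (a - 1) = 2 - a by ring, show 1 - (b - 1) = 2 - b by ring, sub_sub_cancel,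
      sub_add_cancel, sub_add_cancel]
    linear_combination (Real.Gamma σ * (x ^ (-(a - 1) - 1) * (1 - x) ^ (-(b - 1) - 1))) * hG
  refine ⟨combInt r σ (b - 1) (a - 1) (1 / 2), fun x hx => ?_⟩
  exact isOpen_Ioo.is_const_of_deriv_eq_zero isPreconnected_Ioo
    (fun y hy => (hd y hy).differentiableAt.differentiableWithinAt)
    (fun y hy => (hd y hy).deriv) hx ⟨by norm_num, by norm_num⟩

lemma const_mul_one_sub {C : ℝ} (hσ : 0 < σ) (ha : 0 < a) (hb : 0 < b) (hab : a + b + σ = 2)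
    (hC : ∀ x ∈ Set.Ioo (0:ℝ) 1, combInt r σ (b - 1) (a - 1) x = C) :
    C * (1 - a) = (1 - r) * (Real.Gamma a * Real.Gamma (2 - a)) := by
  have h1 := tendsto_combInt_zero (r := r) hσ hb ha
  have hv : binomConv b a 2 0 = a * (a - 1) / 2 := by
    have h2 := succ_mul_choose_succ a 1
    simp [binomConv, Finset.Nat.sum_antidiagonal_succ] at h2 ⊢
    linarith
  have h3 : Filter.Tendsto (fun x => -C * binomConv b a 2 x) (nhdsWithin 0 (Set.Ioi 0))
      (nhds (-C * (a * (a - 1) / 2))) := by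
    rw [← hv]
    exact ((hasDerivAt_binomConv b a 1 0).continuousAt.tendsto.mono_left
      nhdsWithin_le_nhds).const_mul _
  have h4 : (fun x => -C * binomConv b a 2 x) =ᶠ[nhdsWithin 0 (Set.Ioi 0)] combInt r σ b a := by
    filter_upwards [Ioo_mem_nhdsGT (one_pos : (0:ℝ) < 1)] with x hx
    have h := combInt_eq_binomConv_of_const hσ ha hb hab hC 1 1 hx
    simp only [Nat.cast_one, sub_add_cancel, pow_one] at h
    rw [h]
    ring
  have h5 := tendsto_nhds_unique (h3.congr' h4) h1
  have h6 : Real.Gamma (a + 1 + (σ + b)) = 2 := by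
    rw [show a + 1 + (σ + b) = ((2 : ℕ) : ℝ) + 1 by push_cast; linarith, Real.Gamma_nat_eq_factorial]
    norm_num
  rw [h6, Real.Gamma_add_one ha.ne', show σ + b = 2 - a by linarith] at h5
  refine mul_left_cancel₀ ha.ne' ?_
  linear_combination 2 * h5

lemma combInt_eq_pi_div (hσ : 0 < σ) (ha : 0 < a) (hb : 0 < b) (ha1 : a ≤ 1) (hb1 : b ≤ 1)
    (hab : a + b + σ = 2) (hS : 0 < Real.sin (π * a) + Real.sin (π * b))
    (hr : r * (Real.sin (π * a) + Real.sin (π * b)) = Real.sin (π * b)) (x : ℝ)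
    (hx : x ∈ Set.Ioo (0:ℝ) 1) :
    combInt r σ (b - 1) (a - 1) x = π / (Real.sin (π * a) + Real.sin (π * b)) := by
  obtain ⟨C, hC⟩ := exists_combInt_eq_const hσ ha hb ha1 hb1 hab (r := r) (by linarith)
  rw [hC x hx, eq_div_iff hS.ne']
  by_cases h1 : a = 1
  · have hb' : 1 - b ≠ 0 := by linarith
    have h2 := const_mul_one_sub (r := 1 - r) (C := C) hσ hb ha (by linarith) fun y hy => by
      rw [← hC (1 - y) ⟨sub_pos.2 hy.2, sub_lt_self 1 hy.1⟩, ← combInt_symm, sub_sub_cancel]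
    have h3 := Gamma_mul_Gamma_two_sub_mul_sin hb hb1
    refine mul_left_cancel₀ hb' ?_
    linear_combination (Real.sin (π * a) + Real.sin (π * b)) * h2 + h3
      + (Real.Gamma b * Real.Gamma (2 - b)) * hr
  · have ha' : 1 - a ≠ 0 := sub_ne_zero.2 (Ne.symm h1)
    have h2 := const_mul_one_sub hσ ha hb hab hC
    have h3 := Gamma_mul_Gamma_two_sub_mul_sin ha ha1
    refine mul_left_cancel₀ ha' ?_
    linear_combination (Real.sin (π * a) + Real.sin (π * b)) * h2 + h3
      - (Real.Gamma a * Real.Gamma (2 - a)) * hr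

end constant

section fracInt

variable {ι : Type*} {s : Finset ι} {c A B : ι → ℝ} {σ x : ℝ} {w : ℝ → ℝ}

lemma leftFracInt_eq_sum (hσ : 0 < σ) (hA : ∀ i ∈ s, -1 < A i) (hx0 : 0 < x) (hx1 : x < 1)
    (hw : ∀ t ∈ Set.Ioo (0:ℝ) 1, w t = ∑ i ∈ s, c i * (t ^ A i * (1 - t) ^ B i)) :
    leftFracInt σ w x = 1 / Real.Gamma σ * ∑ i ∈ s, c i * leftInt σ (A i) (B i) x := by
  unfold leftFracInt
  congr 1
  have h1 := intervalIntegral.mul_integral_comp_mul_left (a := 0) (b := 1)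
    (f := fun t => w t * (x - t) ^ (σ - 1)) (c := x)
  rw [mul_zero, mul_one] at h1
  rw [← h1, ← intervalIntegral.integral_const_mul]
  simp only [leftInt, eulerInt, ← intervalIntegral.integral_const_mul]
  rw [← intervalIntegral.integral_finsetSum fun i hi => ((intervalIntegrable_eulerInt
    (by linarith [hA i hi]) hσ hx1 (B i)).const_mul _).const_mul _]
  refine intervalIntegral.integral_congr_Ioo_of_le zero_le_one fun t ht => ?_
  have hxt : x * t ∈ Set.Ioo (0:ℝ) 1 := ⟨mul_pos hx0 ht.1, by nlinarith [ht.1, ht.2]⟩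
  simp only [hw _ hxt, Finset.sum_mul, Finset.mul_sum]
  refine Finset.sum_congr rfl fun i _ => ?_
  have e1 : (x - x * t) ^ (σ - 1) = x ^ (σ - 1) * (1 - t) ^ (σ - 1) := by
    rw [← Real.mul_rpow hx0.le (sub_pos.2 ht.2).le, mul_sub, mul_one]
  have e2 : x ^ (A i + σ) = x ^ A i * x ^ (σ - 1) * x := by
    rw [← Real.rpow_add hx0, ← Real.rpow_add_one hx0.ne']
    ring_nf
  rw [e1, e2, Real.mul_rpow hx0.le ht.1.le, add_sub_cancel_right]
  ring

lemma rightFracInt_eq_leftFracInt (σ : ℝ) (w : ℝ → ℝ) (x : ℝ) :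
    rightFracInt σ w x = leftFracInt σ (fun t => w (1 - t)) (1 - x) := by
  have h := intervalIntegral.integral_comp_sub_left (a := 0) (b := 1 - x)
    (fun t => w t * (t - x) ^ (σ - 1)) 1
  rw [sub_sub_cancel, sub_zero] at h
  rw [rightFracInt, leftFracInt, ← h]
  simp only [sub_right_comm]

lemma fracComb_eq_sum {r α : ℝ} (hα : α < 2) (hA : ∀ i ∈ s, -1 < A i) (hB : ∀ i ∈ s, -1 < B i)
    (hx0 : 0 < x) (hx1 : x < 1)
    (hw : ∀ t ∈ Set.Ioo (0:ℝ) 1, w t = ∑ i ∈ s, c i * (t ^ A i * (1 - t) ^ B i)) :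
    fracComb r α w x
      = 1 / Real.Gamma (2 - α) * ∑ i ∈ s, c i * combInt r (2 - α) (A i) (B i) x := by
  have h1 := leftFracInt_eq_sum (sub_pos.2 hα) hA hx0 hx1 hw
  have h2 := leftFracInt_eq_sum (w := fun t => w (1 - t)) (A := B) (B := A) (c := c) (s := s)
    (sub_pos.2 hα) hB (sub_pos.2 hx1) (sub_lt_self 1 hx0) fun t ht => by
      rw [hw (1 - t) ⟨sub_pos.2 ht.2, sub_lt_self 1 ht.1⟩, sub_sub_cancel]
      exact Finset.sum_congr rfl fun _ _ => by ring
  rw [fracComb, rightFracInt_eq_leftFracInt, h1, h2]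
  simp only [combInt, mul_add, Finset.sum_add_distrib, Finset.mul_sum]
  congr 1 <;> exact Finset.sum_congr rfl fun _ _ => by ring

end fracInt

lemma weighted_jacobiG_eq_sum {a b : ℝ} (ha : -1 < a) (hb : -1 < b) (n : ℕ) {t : ℝ}
    (ht : t ∈ Set.Ioo (0:ℝ) 1) :
    (1 - t) ^ a * t ^ b * jacobiG a b n t = ∑ m ∈ Finset.range (n + 1),
      (Ring.choose ((n : ℝ) + a) m * Ring.choose ((n : ℝ) + b) (n - m) * (-1) ^ (n - m)) *
        (t ^ (b + m) * (1 - t) ^ (a + (n - m : ℕ))) := by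
  rw [jacobiG_eq_sum a b ha hb, Finset.mul_sum]
  refine Finset.sum_congr rfl fun m _ => ?_
  rw [Real.rpow_add_natCast ht.1.ne', Real.rpow_add_natCast (sub_pos.2 ht.2).ne',
    show t - 1 = -1 * (1 - t) by ring, mul_pow]
  ring

/-- The weighted Jacobi polynomial is mapped to a multiple of a polynomial of degree `n + 2`. -/
lemma fracComb_weighted_jacobiG {α β r : ℝ} (hα1 : 1 < α) (hα2 : α < 2) (hβ1 : α - 1 ≤ β)
    (hβ2 : β ≤ 1) (hS : 0 < Real.sin (π * (α - β)) + Real.sin (π * β))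
    (hr : r * (Real.sin (π * (α - β)) + Real.sin (π * β)) = Real.sin (π * β))
    (n : ℕ) {x : ℝ} (hx : x ∈ Set.Ioo (0:ℝ) 1) :
    fracComb r α (fun s => (1 - s) ^ (α - β) * s ^ β * jacobiG (α - β) β n s) x
      = -(π / (Real.sin (π * (α - β)) + Real.sin (π * β))) / Real.Gamma (2 - α)
        * Ring.choose (n + α - 2) n * binomConv (n + β) (n + (α - β)) (n + 2) x := by
  have ha : 0 < α - β := by linarith
  have hb : 0 < β := by linarith
  rw [fracComb_eq_sum hα2 (fun m _ => ?_) (fun m _ => ?_) hx.1 hx.2 fun t ht =>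
    weighted_jacobiG_eq_sum (by linarith) (by linarith) n ht]
  · have h := sum_choose_mul_binomConv (α - β) β n (n + 2) x
    rw [show 2 * (n : ℝ) + (α - β) + β - ((n + 2 : ℕ) : ℝ) = n + α - 2 by push_cast; ring] at h
    rw [mul_assoc, ← h, Finset.mul_sum, Finset.mul_sum]
    refine Finset.sum_congr rfl fun m hm => ?_
    have hm : m ≤ n := Nat.lt_succ_iff.1 (Finset.mem_range.1 hm)
    have h1 := combInt_eq_binomConv_of_const (r := r) (σ := 2 - α) (sub_pos.2 hα2) ha hb (by ring)
      (combInt_eq_pi_div (sub_pos.2 hα2) ha hb (by linarith) hβ2 (by ring) hS hr)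
      (m + 1) (n - m + 1) hx
    rw [show β - 1 + ((m + 1 : ℕ) : ℝ) = β + m by push_cast; ring,
      show α - β - 1 + ((n - m + 1 : ℕ) : ℝ) = α - β + (n - m : ℕ) by push_cast; ring,
      show m + 1 + (n - m + 1) = n + 2 by omega, pow_succ] at h1
    rw [h1]
    have h2 : (-1 : ℝ) ^ (n - m) * (-1) ^ (n - m) = 1 := by
      rw [← mul_pow]; norm_num
    linear_combination (-(π / (Real.sin (π * (α - β)) + Real.sin (π * β))) / Real.Gamma (2 - α)
      * Ring.choose ((n : ℝ) + (α - β)) m * Ring.choose ((n : ℝ) + β) (n - m)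
      * binomConv (β + m) (α - β + (n - m : ℕ)) (n + 2) x) * h2
  · have := m.cast_nonneg (α := ℝ)
    linarith
  · have := (n - m).cast_nonneg (α := ℝ)
    linarith

lemma sin_add_sin_pos {α β : ℝ} (hα2 : α < 2) (hβ : 0 < β) (hβ1 : α - 1 ≤ β)
    (hβ2 : β ≤ 1) (hα : β < α) : 0 < Real.sin (π * (α - β)) + Real.sin (π * β) := by
  have hpi := Real.pi_pos
  have h1 : 0 ≤ Real.sin (π * (α - β)) :=
    Real.sin_nonneg_of_nonneg_of_le_pi (by nlinarith) (by nlinarith)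
  have h2 : 0 ≤ Real.sin (π * β) :=
    Real.sin_nonneg_of_nonneg_of_le_pi (by nlinarith) (by nlinarith)
  rcases hβ2.eq_or_lt with rfl | hβ2
  · have := Real.sin_pos_of_pos_of_lt_pi (x := π * (α - 1)) (by nlinarith) (by nlinarith)
    linarith
  · have := Real.sin_pos_of_pos_of_lt_pi (x := π * β) (by nlinarith) (by nlinarith)
    linarith

/-- `𝒩_r^α [ (1-x)^{α-β} x^β G_n^{(α-β,β)}(x) ] = λ_n G_{n+1}^{(β-1,α-β-1)}(x)` on `(0,1)`. -/
theorem N_of_weighted_jacobiG (α β : ℝ) (hα1 : 1 < α) (hα2 : α < 2)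
    (hβ1 : α - 1 ≤ β) (hβ2 : β ≤ 1)
    (r : ℝ) (hr : r = Real.sin (π * β) / (Real.sin (π * (α - β)) + Real.sin (π * β)))
    (n : ℕ) (x : ℝ) (hx : x ∈ Set.Ioo (0:ℝ) 1) :
    HasDerivAt
      (fracComb r α (fun s => (1 - s) ^ (α - β) * s ^ β * jacobiG (α - β) β n s))
      (lamda α β n * jacobiG (β - 1) (α - β - 1) (n + 1) x) x := by
  have hS := sin_add_sin_pos hα2 (by linarith) hβ1 hβ2 (by linarith)
  have hr' : r * (Real.sin (π * (α - β)) + Real.sin (π * β)) = Real.sin (π * β) := by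
    rw [hr, div_mul_cancel₀ _ hS.ne']
  have hg1 := (Real.Gamma_pos_of_pos (sub_pos.2 hα1)).ne'
  have hg2 := (Real.Gamma_pos_of_pos (sub_pos.2 hα2)).ne'
  have hrefl : Real.sin (π * α) * (Real.Gamma (α - 1) * Real.Gamma (2 - α)) = -π := by
    have h1 := Gamma_mul_Gamma_two_sub_mul_sin (sub_pos.2 hα1) (by linarith)
    rw [show 2 - (α - 1) = 2 - α + 1 by ring, Real.Gamma_add_one (sub_pos.2 hα2).ne',
      mul_sub_one, Real.sin_sub_pi] at h1
    refine mul_left_cancel₀ (sub_pos.2 hα2).ne' ?_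
    linear_combination -h1
  have hchoose : (n + α - 1) * Ring.choose ((n : ℝ) + α - 2) n
      = Real.Gamma (n + α) / (n.factorial * Real.Gamma (α - 1)) := by
    have h1 := Gamma_div_eq_choose (α - 1) (sub_pos.2 hα1) n
    have hn := n.cast_nonneg (α := ℝ)
    rw [Real.Gamma_nat_eq_factorial, show α - 1 + n - 1 = n + α - 2 by ring] at h1
    rw [← h1, show (n : ℝ) + α = α - 1 + n + 1 by ring,
      Real.Gamma_add_one (show α - 1 + n ≠ 0 by linarith)]
    ring
  have hd := (hasDerivAt_binomConv (n + β) (n + (α - β)) (n + 1) x).const_mul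
    (-(π / (Real.sin (π * (α - β)) + Real.sin (π * β))) / Real.Gamma (2 - α)
        * Ring.choose ((n : ℝ) + α - 2) n)
  refine (hd.congr_deriv ?_).congr_of_eventuallyEq ?_
  · rw [jacobiG_eq_binomConv _ _ (by linarith) (by linarith), lamda,
      show ((n + 1 : ℕ) : ℝ) + (β - 1) = n + β by push_cast; ring,
      show ((n + 1 : ℕ) : ℝ) + (α - β - 1) = n + (α - β) by push_cast; ring,
      show (n : ℝ) + β + (n + (α - β)) - ((n + 1 : ℕ) : ℝ) = n + α - 1 by push_cast; ring,
      ← mul_assoc]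
    congr 1
    rw [mul_assoc, mul_comm (Ring.choose _ _), hchoose]
    field_simp
    linear_combination -hrefl
  · filter_upwards [Ioo_mem_nhds hx.1 hx.2] with y hy
    exact fracComb_weighted_jacobiG hα1 hα2 hβ1 hβ2 hS hr' n hy
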